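/- arXiv:2204.08139 — 2 statements merged into one kernel-verified Lean document; each statement's English description precedes it below -/
import Mathlib

section
/- There exists a constant C > 0 such that for every continuously differentiable, compactly supported function u : ℝ² → ℝ², the L⁴ norm of u satisfies ‖u‖_{L⁴(ℝ²)} ≤ C · ‖u‖_{L²(ℝ²)}^{1/2} · ‖Du‖_{L²(ℝ²)}^{1/2}, where Du denotes the (total) Fréchet derivative of u and ‖Du‖_{L²} is the L² norm of x ↦ ‖Du(x)‖. -/
open MeasureTheory

theorem lady_aux (u : EuclideanSpace ℝ (Fin 2) → EuclideanSpace ℝ (Fin 2))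
    (hu : ContDiff ℝ 1 u) (x : EuclideanSpace ℝ (Fin 2)) :
    ‖fderiv ℝ (fun x => ‖u x‖ ^ 2) x‖ₑ ≤ 2 * (‖u x‖ₑ * ‖fderiv ℝ u x‖ₑ) := by
  have hd : HasFDerivAt u (fderiv ℝ u x) x :=
    (hu.differentiable (by norm_num) x).hasFDerivAt
  have h := hd.norm_sq
  rw [h.fderiv]
  have h1 : ‖2 • (innerSL ℝ (u x)).comp (fderiv ℝ u x)‖ ≤ 2 * (‖u x‖ * ‖fderiv ℝ u x‖) := by
    rw [two_smul, two_mul]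
    have := ContinuousLinearMap.opNorm_comp_le (innerSL ℝ (u x)) (fderiv ℝ u x)
    rw [innerSL_apply_norm] at this
    exact (norm_add_le _ _).trans (add_le_add this this)
  have h2 := ENNReal.ofReal_le_ofReal h1
  rw [ENNReal.ofReal_mul (by norm_num), ENNReal.ofReal_mul (norm_nonneg _)] at h2
  simpa [ofReal_norm_eq_enorm] using h2

/-- Ladyzhenskaya's interpolation inequality in two dimensions:
there is a constant `C > 0` such that every compactly supported `C¹` vector field
`u : ℝ² → ℝ²` satisfies `‖u‖_{L⁴} ≤ C ‖u‖_{L²}^{1/2} ‖Du‖_{L²}^{1/2}`. -/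
theorem ladyzhenskaya_two_dim :
    ∃ C : ℝ, 0 < C ∧
      ∀ u : EuclideanSpace ℝ (Fin 2) → EuclideanSpace ℝ (Fin 2),
        ContDiff ℝ 1 u → HasCompactSupport u →
        eLpNorm u 4 volume ≤
          ENNReal.ofReal C * eLpNorm u 2 volume ^ ((1 : ℝ) / 2) *
            eLpNorm (fun x => ‖fderiv ℝ u x‖) 2 volume ^ ((1 : ℝ) / 2) := by
  obtain ⟨K, hK⟩ : ∃ K : NNReal, K = lintegralPowLePowLIntegralFDerivConst
    (volume : Measure (EuclideanSpace ℝ (Fin 2))) 2 := ⟨_, rfl⟩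
  refine ⟨(((K + 1) * 4 : NNReal) ^ ((1 : ℝ) / 4) : NNReal), by positivity, ?_⟩
  intro u hu hc
  have hp : Real.HolderConjugate (Module.finrank ℝ (EuclideanSpace ℝ (Fin 2)) : ℝ) 2 := by
    simpa using Real.HolderConjugate.two_two
  have h1 := lintegral_pow_le_pow_lintegral_fderiv
    (volume : Measure (EuclideanSpace ℝ (Fin 2))) (u := fun x => ‖u x‖ ^ 2)
    (hu.norm_sq ℝ) (hc.comp_left (g := fun y => ‖y‖ ^ 2) (by simp)) hp
  rw [← hK] at h1
  have hcd : Continuous (fderiv ℝ u) := hu.continuous_fderiv (by norm_num)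
  have h2 := ENNReal.lintegral_mul_le_Lp_mul_Lq
    (volume : Measure (EuclideanSpace ℝ (Fin 2))) Real.HolderConjugate.two_two
    (f := fun x => ‖u x‖ₑ) (g := fun x => ‖fderiv ℝ u x‖ₑ)
    hu.continuous.enorm.aemeasurable hcd.enorm.aemeasurable
  have hA : eLpNorm u 2 volume = (∫⁻ x, ‖u x‖ₑ ^ (2:ℝ)) ^ ((1:ℝ)/2) := by
    rw [eLpNorm_eq_lintegral_rpow_enorm_toReal (by norm_num) (by norm_num)]; simp
  have hB : eLpNorm (fun x => ‖fderiv ℝ u x‖) 2 volume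
      = (∫⁻ x, ‖fderiv ℝ u x‖ₑ ^ (2:ℝ)) ^ ((1:ℝ)/2) := by
    rw [eLpNorm_norm, eLpNorm_eq_lintegral_rpow_enorm_toReal (by norm_num) (by norm_num)]; simp
  have h4 : eLpNorm u 4 volume = (∫⁻ x, ‖‖u x‖ ^ 2‖ₑ ^ (2:ℝ)) ^ ((1:ℝ)/4) := by
    rw [eLpNorm_eq_lintegral_rpow_enorm_toReal (by norm_num) (by norm_num)]
    congr 1
    · congr 1
      ext x
      rw [enorm_pow, enorm_norm, ← ENNReal.rpow_natCast, ← ENNReal.rpow_mul]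
      norm_num
  simp only [Pi.mul_apply] at h2
  rw [← hA, ← hB] at h2
  rw [h4]
  set A := eLpNorm u 2 volume
  set B := eLpNorm (fun x => ‖fderiv ℝ u x‖) 2 volume
  have h3 : ∫⁻ x, ‖fderiv ℝ (fun x => ‖u x‖ ^ 2) x‖ₑ ≤ 2 * (A * B) := by
    refine (lintegral_mono (lady_aux u hu)).trans ?_
    rw [lintegral_const_mul' _ _ (by norm_num)]
    gcongr
  have h5 : ∫⁻ x, ‖‖u x‖ ^ 2‖ₑ ^ (2:ℝ) ≤ (((K + 1) * 4 : NNReal) : ENNReal) * (A * B) ^ (2:ℝ) := by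
    refine h1.trans ?_
    calc (K : ENNReal) * (∫⁻ x, ‖fderiv ℝ (fun x => ‖u x‖ ^ 2) x‖ₑ) ^ (2:ℝ)
        ≤ ((K + 1 : NNReal) : ENNReal) * (2 * (A * B)) ^ (2:ℝ) := by
          gcongr
          simp
      _ = _ := by
          rw [ENNReal.mul_rpow_of_nonneg _ _ (by norm_num), ENNReal.coe_mul, mul_assoc]
          norm_num
  calc _ ≤ ((((K + 1) * 4 : NNReal) : ENNReal) * (A * B) ^ (2:ℝ)) ^ ((1:ℝ)/4) := by gcongr
    _ = _ := by
      rw [ENNReal.mul_rpow_of_nonneg _ _ (by norm_num), ← ENNReal.rpow_mul,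
        ENNReal.mul_rpow_of_nonneg _ _ (by norm_num), ENNReal.ofReal_coe_nnreal,
        ENNReal.coe_rpow_of_nonneg _ (by norm_num), mul_assoc]
      norm_num
end

section
/- Let D ⊆ ℝ² × ℝ and let ν be a probability measure on D. Let Pr, Ra > 0, ξ ∈ ℝ² a fixed unit vector, f : ℝ² × ℝ → ℝ² a given function, and let u, U : ℝ² × ℝ → ℝ² be twice differentiable in space and differentiable in time, p, P : ℝ² × ℝ → ℝ differentiable in space, θ, Θ : ℝ² × ℝ → ℝ. Suppose the Navier–Stokes–Boussinesq residual vanishes pointwise on D: ∂ₜu − Pr·Δu + (u·∇)u + ∇p − Pr·Ra·ξ·θ − f = 0. Suppose that on D: |∂ₜU − ∂ₜu| ≤ ε₁, |ΔU − Δu| ≤ δ, |∇P − ∇p| ≤ ε₅, |Θ − θ| ≤ ε₃, |U − u| ≤ ε₁, ‖∇U − ∇u‖ ≤ ε₁, ‖∇U‖ ≤ M₁, and |u| ≤ M₂ (with ‖·‖ the operator norm of the spatial Jacobian). Then ∫_D |∂ₜU − Pr·ΔU + (U·∇)U + ∇P − Pr·Ra·ξ·Θ − f|² dν ≤ (ε₁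 + Pr·δ + ε₅ + Pr·Ra·ε₃ + (M₁ + M₂)·ε₁)². -/
open MeasureTheory

noncomputable abbrev E2 : Type := EuclideanSpace ℝ (Fin 2)

/-- Time derivative of a (space × time)-dependent vector field. -/
noncomputable def dtv (v : E2 × ℝ → E2) (z : E2 × ℝ) : E2 :=
  deriv (fun s => v (z.1, s)) z.2

/-- Spatial Jacobian of a (space × time)-dependent vector field. -/
noncomputable def sjac (v : E2 × ℝ → E2) (z : E2 × ℝ) : E2 →L[ℝ] E2 :=
  fderiv ℝ (fun y => v (y, z.2)) z.1

/-- Spatial (componentwise) vector Laplacian of a (space × time)-dependent vector field. -/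
noncomputable def slap (v : E2 × ℝ → E2) (z : E2 × ℝ) : E2 :=
  ∑ i : Fin 2,
    fderiv ℝ (fderiv ℝ fun y => v (y, z.2)) z.1 (EuclideanSpace.single i 1)
      (EuclideanSpace.single i 1)

/-- Spatial gradient of a (space × time)-dependent scalar field. -/
noncomputable def sgrad (q : E2 × ℝ → ℝ) (z : E2 × ℝ) : E2 :=
  gradient (fun y => q (y, z.2)) z.1

/-- estimate (3.2) in the proof of Theorem 1: if the
Navier–Stokes–Boussinesq residual `∂ₜu − Pr Δu + (u·∇)u + ∇p − Pr Ra ξ θ − f`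
vanishes on `D` and the stated uniform closeness and boundedness hypotheses hold on `D`,
then the squared `L²(ν)`-loss of the approximate residual is bounded by
`(ε₁ + Pr δ + ε₅ + Pr Ra ε₃ + (M₁ + M₂) ε₁)²`. -/
theorem navier_stokes_residual_loss_bound
    (D : Set (E2 × ℝ)) (ν : Measure (E2 × ℝ)) [IsProbabilityMeasure ν]
    (Pr Ra : ℝ) (hPr : 0 < Pr) (hRa : 0 < Ra)
    (ξ : E2) (hξ : ‖ξ‖ = 1) (f : E2 × ℝ → E2)
    (u U : E2 × ℝ → E2) (p P : E2 × ℝ → ℝ) (θ Θ : E2 × ℝ → ℝ)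
    (ε₁ ε₃ ε₅ δ M₁ M₂ : ℝ)
    (hu1 : ∀ t, Differentiable ℝ fun y => u (y, t))
    (hu2 : ∀ t, Differentiable ℝ (fderiv ℝ fun y => u (y, t)))
    (hut : ∀ x, Differentiable ℝ fun s => u (x, s))
    (hU1 : ∀ t, Differentiable ℝ fun y => U (y, t))
    (hU2 : ∀ t, Differentiable ℝ (fderiv ℝ fun y => U (y, t)))
    (hUt : ∀ x, Differentiable ℝ fun s => U (x, s))
    (hp : ∀ t, Differentiable ℝ fun y => p (y, t))
    (hP : ∀ t, Differentiable ℝ fun y => P (y, t))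
    (hres : ∀ z ∈ D,
      dtv u z - Pr • slap u z + sjac u z (u z) + sgrad p z - (Pr * Ra * θ z) • ξ - f z = 0)
    (h₁ : ∀ z ∈ D, ‖dtv U z - dtv u z‖ ≤ ε₁)
    (h₂ : ∀ z ∈ D, ‖slap U z - slap u z‖ ≤ δ)
    (h₃ : ∀ z ∈ D, ‖sgrad P z - sgrad p z‖ ≤ ε₅)
    (h₄ : ∀ z ∈ D, |Θ z - θ z| ≤ ε₃)
    (h₅ : ∀ z ∈ D, ‖U z - u z‖ ≤ ε₁)
    (h₆ : ∀ z ∈ D, ‖sjac U z - sjac u z‖ ≤ ε₁)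
    (h₇ : ∀ z ∈ D, ‖sjac U z‖ ≤ M₁)
    (h₈ : ∀ z ∈ D, ‖u z‖ ≤ M₂) :
    (∫ z in D,
        ‖dtv U z - Pr • slap U z + sjac U z (U z) + sgrad P z - (Pr * Ra * Θ z) • ξ -
            f z‖ ^ 2 ∂ν) ≤
      (ε₁ + Pr * δ + ε₅ + Pr * Ra * ε₃ + (M₁ + M₂) * ε₁) ^ 2 := by
  set C := ε₁ + Pr * δ + ε₅ + Pr * Ra * ε₃ + (M₁ + M₂) * ε₁ with hC
  have key : ∀ z ∈ D, ‖dtv U z - Pr • slap U z + sjac U z (U z) + sgrad P z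
      - (Pr * Ra * Θ z) • ξ - f z‖ ≤ C := by
    intro z hz
    have e : dtv U z - Pr • slap U z + sjac U z (U z) + sgrad P z
        - (Pr * Ra * Θ z) • ξ - f z
        = (dtv U z - dtv u z) + (-(Pr • (slap U z - slap u z))) + (sgrad P z - sgrad p z)
          + (-((Pr * Ra * (Θ z - θ z)) • ξ))
          + (sjac U z (U z - u z) + (sjac U z - sjac u z) (u z)) := by
      rw [← sub_zero (dtv U z - Pr • slap U z + sjac U z (U z) + sgrad P z
        - (Pr * Ra * Θ z) • ξ - f z), ← hres z hz]
      simp only [map_sub, ContinuousLinearMap.sub_apply, mul_sub, sub_smul, smul_sub]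
      abel
    have a2 : ‖-(Pr • (slap U z - slap u z))‖ ≤ Pr * δ := by
      rw [norm_neg, norm_smul, Real.norm_of_nonneg hPr.le]
      exact mul_le_mul_of_nonneg_left (h₂ z hz) hPr.le
    have a4 : ‖-((Pr * Ra * (Θ z - θ z)) • ξ)‖ ≤ Pr * Ra * ε₃ := by
      rw [norm_neg, norm_smul, hξ, mul_one, norm_mul,
        Real.norm_of_nonneg (mul_pos hPr hRa).le, Real.norm_eq_abs]
      exact mul_le_mul_of_nonneg_left (h₄ z hz) (mul_pos hPr hRa).le
    have hM : 0 ≤ M₁ := (norm_nonneg _).trans (h₇ z hz)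
    have he : 0 ≤ ε₁ := (norm_nonneg _).trans (h₅ z hz)
    have a5 : ‖sjac U z (U z - u z)‖ ≤ M₁ * ε₁ :=
      (ContinuousLinearMap.le_opNorm _ _).trans
        (mul_le_mul (h₇ z hz) (h₅ z hz) (norm_nonneg _) hM)
    have a6 : ‖(sjac U z - sjac u z) (u z)‖ ≤ ε₁ * M₂ :=
      (ContinuousLinearMap.le_opNorm _ _).trans
        (mul_le_mul (h₆ z hz) (h₈ z hz) (norm_nonneg _) he)
    rw [e]
    have b := norm_add_le_of_le (norm_add_le_of_le (norm_add_le_of_le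
      (norm_add_le_of_le (h₁ z hz) a2) (h₃ z hz)) a4) (norm_add_le_of_le a5 a6)
    refine b.trans (le_of_eq ?_)
    rw [hC]; ring
  have hb := norm_setIntegral_le_of_norm_le_const (μ := ν) (s := D) (C := C ^ 2)
    (f := fun z => ‖dtv U z - Pr • slap U z + sjac U z (U z) + sgrad P z
      - (Pr * Ra * Θ z) • ξ - f z‖ ^ 2) (measure_lt_top ν D) (by
      intro z hz
      rw [Real.norm_of_nonneg (by positivity)]
      exact pow_le_pow_left₀ (norm_nonneg _) (key z hz) 2)
  refine (le_abs_self _).trans (hb.trans ?_)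
  exact mul_le_of_le_one_right (sq_nonneg C) measureReal_le_one
end
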